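/- arXiv:1206.3483 — 6 statements merged into one kernel-verified Lean document; each statement's English description precedes it below -/
import Mathlib

section
/- Let k, m be natural numbers and let v : Fin m → (Fin k → ZMod 2). In the group algebra AddMonoidAlgebra (ZMod 2) (Fin k → ZMod 2), the product ∏ i, (single 0 1 + single (v i) 1) is nonzero if and only if the family v is linearly independent over ZMod 2. (The survival property and its negative form: the product (v₀+v₁)(v₀+v₂)⋯(v₀+v_m) is nonzero exactly when the vectors v₁,…,v_m are linearly independent over F₂.) -/
theorem survival_expand (k m : ℕ) (v : Fin m → (Fin k → ZMod 2)) :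
    (∏ i : Fin m, (AddMonoidAlgebra.single (0 : Fin k → ZMod 2) (1 : ZMod 2) +
        AddMonoidAlgebra.single (v i) (1 : ZMod 2))) =
      ∑ t ∈ (Finset.univ : Finset (Fin m)).powerset,
        AddMonoidAlgebra.single (∑ i ∈ t, v i) (1 : ZMod 2) := by
  rw [← AddMonoidAlgebra.one_def, Finset.prod_one_add]
  refine Finset.sum_congr rfl fun t _ => ?_
  induction t using Finset.induction_on with
  | empty => simp [AddMonoidAlgebra.one_def]
  | insert a s ha ih =>
    rw [Finset.prod_insert ha, Finset.sum_insert ha, ih (by simp),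
      AddMonoidAlgebra.single_mul_single, one_mul]

theorem survival_char (k : ℕ) (x : Fin k → ZMod 2) : x + x = 0 := by
  funext j
  exact CharTwo.add_self_eq_zero (x j)

theorem survival_symm (k m : ℕ) (v : Fin m → (Fin k → ZMod 2)) (s t : Finset (Fin m)) :
    ∑ i ∈ symmDiff t s, v i = ∑ i ∈ t, v i + ∑ i ∈ s, v i := by
  have key : ∀ u : Finset (Fin m), ∑ i ∈ u, v i = ∑ i, if i ∈ u then v i else 0 := by
    intro u
    simp
  rw [key, key t, key s, ← Finset.sum_add_distrib]
  refine Finset.sum_congr rfl fun i _ => ?_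
  by_cases ht : i ∈ t <;> by_cases hs : i ∈ s <;>
    simp [Finset.mem_symmDiff, ht, hs, survival_char]

/-- **Survival property (and its negative form).** In the group algebra
`(ZMod 2)[(ZMod 2)^k]`, the product `(v₀ + v₁)(v₀ + v₂)⋯(v₀ + v_m)` is nonzero
if and only if the vectors `v₁, …, v_m` are linearly independent over `ZMod 2`. -/
theorem survival_property (k m : ℕ) (v : Fin m → (Fin k → ZMod 2)) :
    (∏ i : Fin m, (AddMonoidAlgebra.single (0 : Fin k → ZMod 2) (1 : ZMod 2) +
        AddMonoidAlgebra.single (v i) (1 : ZMod 2))) ≠ 0 ↔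
      LinearIndependent (ZMod 2) v := by
  rw [survival_expand]
  constructor
  · intro h
    rw [Fintype.linearIndependent_iff]
    intro g hg
    by_contra! hne
    obtain ⟨i0, hi0⟩ := hne
    apply h
    have h01 : ∀ a : ZMod 2, a ≠ 0 → a = 1 := by decide
    have hs : ∑ i ∈ Finset.univ.filter (fun i => g i ≠ 0), v i = 0 := by
      rw [Finset.sum_filter]
      refine Eq.trans ?_ hg
      refine Finset.sum_congr rfl fun i _ => ?_
      by_cases hi : g i = 0
      · simp [hi]
      · simp [h01 _ hi]
    have hi0s : i0 ∈ Finset.univ.filter (fun i => g i ≠ 0) := by simp [hi0]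
    generalize Finset.univ.filter (fun i => g i ≠ 0) = s at hs hi0s
    refine Finset.sum_involution (fun t _ => symmDiff t s) ?_ ?_ ?_ ?_
    · intro t _
      rw [survival_symm, hs, add_zero, ← AddMonoidAlgebra.single_add,
        CharTwo.add_self_eq_zero, AddMonoidAlgebra.single_zero]
    · intro t _ _ hts
      rw [symmDiff_eq_left] at hts
      simp [hts] at hi0s
    · intro t _
      simp
    · intro t _
      simp
  · intro h h0
    have h1 := congrArg (fun x => AddMonoidAlgebra.coeff x 0) h0
    simp only [AddMonoidAlgebra.coeff_sum, AddMonoidAlgebra.coeff_single,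
      Finsupp.finsetSum_apply, AddMonoidAlgebra.coeff_zero, Finsupp.coe_zero,
      Pi.zero_apply] at h1
    rw [Finset.sum_eq_single ∅] at h1
    · simp at h1
    · intro t _ ht
      refine Finsupp.single_eq_of_ne fun hh => ht ?_
      rw [Finset.eq_empty_iff_forall_notMem]
      intro i hi
      exact one_ne_zero (linearIndependent_iff'.1 h t (fun _ => 1) (by simp [← hh]) i hi)
    · simp
end

section
/- Let F be a field of characteristic 2, let k, m be natural numbers, let a : Fin m → F and v : Fin m → (Fin k → ZMod 2). In the group algebra AddMonoidAlgebra F (Fin k → ZMod 2), the product ∏ i, (single 0 (a i) + single (v i) (a i)) is nonzero if and only if every a i is nonzero and the family v is linearly independent over ZMod 2. (Survival property with field multipliers, used when evaluating the circuit over F[Z₂^k] with F = GF(2^(3+log₂ k)).) -/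
theorem surv_expand (F : Type*) [Field F] (k m : ℕ) (a : Fin m → F)
    (v : Fin m → (Fin k → ZMod 2)) (S : Finset (Fin m)) :
    (∏ i ∈ S, (AddMonoidAlgebra.single (0 : Fin k → ZMod 2) (a i) +
        AddMonoidAlgebra.single (v i) (a i))) =
      ∑ T ∈ S.powerset, AddMonoidAlgebra.single (∑ i ∈ T, v i) (∏ i ∈ S, a i) := by
  have hp : ∀ (T : Finset (Fin m)) (w : Fin m → (Fin k → ZMod 2)),
      (∏ i ∈ T, AddMonoidAlgebra.single (w i) (a i)) =
        AddMonoidAlgebra.single (∑ i ∈ T, w i) (∏ i ∈ T, a i) := by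
    intro T w
    induction T using Finset.induction_on with
    | empty => simp [AddMonoidAlgebra.one_def]
    | insert i T hi ih =>
      rw [Finset.prod_insert hi, Finset.prod_insert hi, Finset.sum_insert hi, ih,
        AddMonoidAlgebra.single_mul_single]
  simp_rw [add_comm (AddMonoidAlgebra.single (0 : Fin k → ZMod 2) _)]
  rw [Finset.prod_add]
  refine Finset.sum_congr rfl fun T hT => ?_
  rw [hp T v, hp (S \ T) (fun _ => 0), AddMonoidAlgebra.single_mul_single]
  rw [mul_comm, Finset.prod_sdiff (Finset.mem_powerset.1 hT)]
  simp

theorem surv_zero (F : Type*) [Field F] [CharP F 2] (k m : ℕ) (a : Fin m → F)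
    (v : Fin m → (Fin k → ZMod 2)) (S : Finset (Fin m)) (hS : S.Nonempty)
    (h0 : ∑ i ∈ S, v i = 0) :
    (∏ i ∈ S, (AddMonoidAlgebra.single (0 : Fin k → ZMod 2) (a i) +
        AddMonoidAlgebra.single (v i) (a i))) = 0 := by
  rw [surv_expand]
  refine Finset.sum_involution (fun T _ => S \ T) ?_ ?_ ?_ ?_
  · intro T hT
    have h1 := Finset.sum_sdiff (f := v) (Finset.mem_powerset.1 hT)
    rw [h0] at h1
    have h2 : ∑ i ∈ S \ T, v i = ∑ i ∈ T, v i := by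
      rw [eq_neg_of_add_eq_zero_left h1]
      funext j
      exact ZMod.neg_eq_self_mod_two _
    rw [h2, ← AddMonoidAlgebra.single_add, CharTwo.add_self_eq_zero,
      AddMonoidAlgebra.single_zero]
  · intro T hT _ h
    obtain ⟨i, hi⟩ := hS
    have := Finset.ext_iff.1 h i
    simp [hi] at this
  · intro T hT
    simp
  · intro T hT
    exact Finset.sdiff_sdiff_eq_self (Finset.mem_powerset.1 hT)

theorem zmod2_cases (x : ZMod 2) : x = 0 ∨ x = 1 := by
  revert x; decide

/-- **Survival property with field multipliers.** Let `F` be a field of characteristic 2.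
In the group algebra `F[(ZMod 2)^k]`, the product
`∏ i, (a i • v₀ + a i • v i)` (written with `single`) is nonzero if and only if
every multiplier `a i` is nonzero and the vectors `v₁, …, v_m` are linearly
independent over `ZMod 2`. -/
theorem survival_property_with_multipliers (F : Type*) [Field F] [CharP F 2]
    (k m : ℕ) (a : Fin m → F) (v : Fin m → (Fin k → ZMod 2)) :
    (∏ i : Fin m, (AddMonoidAlgebra.single (0 : Fin k → ZMod 2) (a i) +
        AddMonoidAlgebra.single (v i) (a i))) ≠ 0 ↔
      (∀ i, a i ≠ 0) ∧ LinearIndependent (ZMod 2) v := by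
  constructor
  · intro h
    refine ⟨fun i hi => h (Finset.prod_eq_zero (Finset.mem_univ i) (by simp [hi])), ?_⟩
    by_contra hl
    obtain ⟨g, hg, i, hi⟩ := Fintype.not_linearIndependent_iff.1 hl
    apply h
    rw [← Finset.prod_sdiff (Finset.subset_univ (Finset.univ.filter fun i => g i ≠ 0)),
      surv_zero F k m a v (Finset.univ.filter fun i => g i ≠ 0) ⟨i, by simp [hi]⟩ ?_, mul_zero]
    rw [← hg, Finset.sum_filter]
    refine Finset.sum_congr rfl fun j _ => ?_
    rcases zmod2_cases (g j) with h | h <;> simp [h]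
  · rintro ⟨ha, hl⟩ h
    rw [surv_expand] at h
    have h1 := congrArg (fun f => f.coeff 0) h
    have hc : ∀ T : Finset (Fin m), ∑ i ∈ T, v i = 0 ↔ T = ∅ := by
      intro T
      constructor
      · intro hT
        have := linearIndependent_iff'.1 hl T (fun _ => 1) (by simpa using hT)
        exact Finset.eq_empty_of_forall_notMem fun i hi => one_ne_zero (this i hi)
      · rintro rfl; simp
    simp [AddMonoidAlgebra.coeff_sum, Finsupp.single_apply, hc, Finset.prod_eq_zero_iff, ha] at h1
end

section
/- Constrained annihilation property. Let k, m be natural numbers, let 𝒞 be a finite type of colors, μ : 𝒞 → ℕ a multiplicity function, and for each color c let S c be a ZMod 2-submodule of Fin k → ZMod 2 with finrank (S c) = μ c. Let χ : Fin m → 𝒞 be a coloring and v : Fin m → (Fin k → ZMod 2) a family of vectors with v i ∈ S (χ i) for every i. If there exists a color c such that the number of indices i with χ i = c exceeds μ c, then in AddMonoidAlgebra (ZMod 2) (Fin k → ZMod 2) the product ∏ i, (single 0 1 + single (v i) 1) equals 0. (A multilinear term containing more than μ(c) variables of color c evaluates to 0, because the corresponding vectors lie in the μ(c)-dimensional subspace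 S_c and hence are linearly dependent.) -/
theorem add_self_aux {k : ℕ} (x : AddMonoidAlgebra (ZMod 2) (Fin k → ZMod 2)) : x + x = 0 := by
  rw [← two_smul (ZMod 2) x, show (2 : ZMod 2) = 0 from rfl, zero_smul]

theorem ann_aux {k m : ℕ} (v : Fin m → (Fin k → ZMod 2)) (U : Finset (Fin m))
    (w : Fin k → ZMod 2) (hw : w ∈ Submodule.span (ZMod 2) (v '' (U : Set (Fin m)))) :
    (∏ i ∈ U, (AddMonoidAlgebra.single (0 : Fin k → ZMod 2) (1 : ZMod 2) +
        AddMonoidAlgebra.single (v i) (1 : ZMod 2))) * AddMonoidAlgebra.single w (1 : ZMod 2) =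
    ∏ i ∈ U, (AddMonoidAlgebra.single (0 : Fin k → ZMod 2) (1 : ZMod 2) +
        AddMonoidAlgebra.single (v i) (1 : ZMod 2)) := by
  induction hw using Submodule.span_induction with
  | mem x hx =>
    obtain ⟨i, hi, rfl⟩ := hx
    have h2 : v i + v i = 0 := by
      rw [← two_smul (ZMod 2) (v i), show (2 : ZMod 2) = 0 from rfl, zero_smul]
    rw [← Finset.prod_erase_mul _ _ (Finset.mem_coe.1 hi), mul_assoc, add_mul,
      AddMonoidAlgebra.single_mul_single, AddMonoidAlgebra.single_mul_single, h2, zero_add,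
      mul_one, add_comm (AddMonoidAlgebra.single (v i) (1 : ZMod 2))]
  | zero => rw [← AddMonoidAlgebra.one_def, mul_one]
  | add x y _ _ hx hy =>
    have : AddMonoidAlgebra.single (x + y) (1 : ZMod 2) =
        AddMonoidAlgebra.single x 1 * AddMonoidAlgebra.single y 1 := by
      rw [AddMonoidAlgebra.single_mul_single, mul_one]
    rw [this, ← mul_assoc, hx, hy]
  | smul a x _ hx =>
    have ha : a = 0 ∨ a = 1 := by
      revert a; decide
    rcases ha with rfl | rfl
    · rw [zero_smul, ← AddMonoidAlgebra.one_def, mul_one]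
    · rw [one_smul, hx]

open Classical in
/-- **Constrained annihilation property.** Let each color `c` have a `ZMod 2`-subspace
`S c ≤ (ZMod 2)^k` of dimension `μ c`, let `χ` color the indices and let `v i ∈ S (χ i)`.
If some color `c` appears on more than `μ c` indices, then the product
`(v₀ + v₁)⋯(v₀ + v_m)` in the group algebra `(ZMod 2)[(ZMod 2)^k]` is zero. -/
theorem constrained_annihilation (k m : ℕ) (𝒞 : Type*) [Fintype 𝒞] (μ : 𝒞 → ℕ)
    (S : 𝒞 → Submodule (ZMod 2) (Fin k → ZMod 2))
    (hdim : ∀ c, Module.finrank (ZMod 2) (S c) = μ c)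
    (χ : Fin m → 𝒞) (v : Fin m → (Fin k → ZMod 2))
    (hv : ∀ i, v i ∈ S (χ i))
    (c : 𝒞) (hc : μ c < (Finset.univ.filter fun i => χ i = c).card) :
    (∏ i : Fin m, (AddMonoidAlgebra.single (0 : Fin k → ZMod 2) (1 : ZMod 2) +
        AddMonoidAlgebra.single (v i) (1 : ZMod 2))) = 0 := by
  have hnli : ¬ LinearIndependent (ZMod 2) v := by
    intro hli
    have h1 : LinearIndependent (ZMod 2) (fun i : {i // χ i = c} => v i.1) :=
      hli.comp _ Subtype.val_injective
    have h2 : LinearIndependent (ZMod 2)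
        (fun i : {i // χ i = c} => (⟨v i.1, by have := hv i.1; rwa [i.2] at this⟩ : S c)) :=
      LinearIndependent.of_comp (S c).subtype h1
    have h3 := h2.fintype_card_le_finrank
    rw [hdim, Fintype.card_subtype] at h3
    omega
  rw [linearIndependent_iff_notMem_span] at hnli
  push Not at hnli
  obtain ⟨j, hj⟩ := hnli
  rw [← Finset.mul_prod_erase _ _ (Finset.mem_univ j), mul_comm]
  have h := ann_aux v (Finset.univ.erase j) (v j) (by simpa [Set.compl_eq_univ_diff] using hj)
  rw [mul_add, h, ← AddMonoidAlgebra.one_def, mul_one, add_self_aux]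
end

section
/- For every natural number n, the real number ∏_{i=1}^{n} (1 − 2^(−i)) is greater than 1/4. -/
lemma prod_aux (n : ℕ) :
    1 / 4 + (1 / 2 : ℝ) ^ (n + 2) ≤ ∏ i ∈ Finset.Icc 1 (n + 1), (1 - (1 / 2 : ℝ) ^ i) := by
  induction n with
  | zero => norm_num
  | succ k ih =>
    rw [Finset.prod_Icc_succ_top (by omega)]
    have h0 : (0 : ℝ) < (1 / 2 : ℝ) ^ k := by positivity
    have h1 : (1 / 2 : ℝ) ^ k ≤ 1 := pow_le_one₀ (by norm_num) (by norm_num)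
    have e2 : (1 / 2 : ℝ) ^ (k + 2) = (1 / 2 : ℝ) ^ k / 4 := by ring
    have e3 : (1 / 2 : ℝ) ^ (k + 1 + 2) = (1 / 2 : ℝ) ^ k / 8 := by ring
    have e4 : (1 / 2 : ℝ) ^ (k + 1 + 1) = (1 / 2 : ℝ) ^ k / 4 := by ring
    rw [e2] at ih
    rw [e3, e4]
    have h2 : (0 : ℝ) ≤ 1 - (1 / 2 : ℝ) ^ k / 4 := by linarith
    have h3 := mul_le_mul_of_nonneg_right ih h2
    nlinarith

/-- For every natural number `n`, the real product `∏_{i=1}^{n} (1 − 2^{−i})` is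
greater than `1/4`. (It is the probability that `n` uniform random vectors of
`(ZMod 2)^n` are linearly independent.) -/
theorem prod_one_sub_two_pow_gt_quarter (n : ℕ) :
    ∏ i ∈ Finset.Icc 1 n, (1 - (1 / 2 : ℝ) ^ i) > 1 / 4 := by
  cases n with
  | zero => norm_num
  | succ k =>
    have h := prod_aux k
    have h0 : (0 : ℝ) < (1 / 2 : ℝ) ^ (k + 2) := by positivity
    linarith
end

section
/- For every natural number t ≥ 1, the rational number p_t satisfies p_t > 1/4, where p_t := ∏_{i=1}^{t-1} (2^t − 2^(t−i))/(2^t − 1) (so p_1 = 1, the empty product). -/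
/-- The subspace survival probability for a color group of size `t`:
`p t = ∏_{i=1}^{t-1} (2^t − 2^(t−i))/(2^t − 1)`, with `p 1 = 1` (the empty product).
It is the probability that `t` uniformly random nonzero vectors of `(ZMod 2)^t` are
linearly independent over `ZMod 2`. -/
def p (t : ℕ) : ℚ :=
  ∏ i ∈ Finset.Icc 1 (t - 1), ((2 ^ t - 2 ^ (t - i)) / (2 ^ t - 1) : ℚ)

theorem aux_prod (n : ℕ) :
    (1 / 4 : ℚ) + (1 / 2) ^ (n + 2) ≤ ∏ i ∈ Finset.Icc 1 (n + 1), (1 - (1 / 2 : ℚ) ^ i) := by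
  induction n with
  | zero => norm_num
  | succ n ih =>
    rw [Finset.prod_Icc_succ_top (by omega)]
    have h1 : (1 / 2 : ℚ) ^ n ≤ 1 := pow_le_one₀ (by norm_num) (by norm_num)
    have h0 : (0 : ℚ) < (1 / 2 : ℚ) ^ n := by positivity
    have e2 : (1 / 2 : ℚ) ^ (n + 2) = (1 / 2) ^ n / 4 := by ring
    have e2' : (1 / 2 : ℚ) ^ (n + 1 + 1) = (1 / 2) ^ n / 4 := by ring
    have e3 : (1 / 2 : ℚ) ^ (n + 1 + 2) = (1 / 2) ^ n / 8 := by ring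
    rw [e2] at ih
    rw [e2', e3]
    refine le_trans ?_ (mul_le_mul_of_nonneg_right ih (by linarith))
    nlinarith [mul_nonneg h0.le (sub_nonneg.2 h1)]

/-- For every `t ≥ 1`, the subspace survival probability satisfies `p t > 1/4`. -/
theorem p_gt_quarter (t : ℕ) (ht : 1 ≤ t) : p t > 1 / 4 := by
  obtain ⟨m, rfl⟩ : ∃ m, t = m + 1 := ⟨t - 1, by omega⟩
  cases m with
  | zero => norm_num [p]
  | succ n =>
    have h := aux_prod n
    have h0 : (0 : ℚ) < (1 / 2 : ℚ) ^ (n + 2) := by positivity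
    have key : ∏ i ∈ Finset.Icc 1 (n + 1), (1 - (1 / 2 : ℚ) ^ i) ≤ p (n + 1 + 1) := by
      unfold p
      apply Finset.prod_le_prod
      · intro i _
        exact sub_nonneg.2 (pow_le_one₀ (by norm_num) (by norm_num))
      · intro i hi
        rw [Finset.mem_Icc] at hi
        have hT : (1 : ℚ) < 2 ^ (n + 1 + 1) := one_lt_pow₀ (by norm_num) (by omega)
        have e : (2 : ℚ) ^ (n + 1 + 1 - i) = 2 ^ (n + 1 + 1) * (1 / 2) ^ i := by
          have : (2 : ℚ) ^ (n + 1 + 1) = 2 ^ (n + 1 + 1 - i) * 2 ^ i := by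
            rw [← pow_add]; congr 1; omega
          rw [this, mul_assoc, ← mul_pow]; norm_num
        have hx : (1 / 2 : ℚ) ^ i ≤ 1 := pow_le_one₀ (by norm_num) (by norm_num)
        rw [e, le_div_iff₀ (by linarith)]
        nlinarith
    linarith
end

section
/- For every natural number t ≥ 1, one has (p_t)³ ≥ (24/49)^t in ℚ, where p_t := ∏_{i=1}^{t-1} (2^t − 2^(t−i))/(2^t − 1). Note that 24/49 = p_3, so equivalently p_t ≥ p_3^(t/3) for every t ≥ 1. -/
lemma euler_lb (n : ℕ) (hn : 1 ≤ n) :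
    (1 / 4 + (1 / 2) ^ (n + 1) : ℚ) ≤ ∏ i ∈ Finset.Icc 1 n, (1 - (1 / 2 : ℚ) ^ i) := by
  induction n, hn using Nat.le_induction with
  | base => norm_num
  | succ n hn ih =>
    rw [Finset.prod_Icc_succ_top (by omega)]
    have hx0 : (0 : ℚ) < (1 / 2) ^ (n + 1) := by positivity
    have hx : ((1 / 2 : ℚ)) ^ (n + 1) ≤ (1 / 2) ^ 2 :=
      pow_le_pow_of_le_one (by norm_num) (by norm_num) (by omega)
    rw [pow_succ (1 / 2 : ℚ) (n + 1)]
    generalize (1 / 2 : ℚ) ^ (n + 1) = x at *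
    have h1 : (1 / 4 + x) * (1 - x) ≤ (∏ i ∈ Finset.Icc 1 n, (1 - (1 / 2 : ℚ) ^ i)) * (1 - x) :=
      mul_le_mul_of_nonneg_right ih (by linarith)
    nlinarith

lemma p_lb (t : ℕ) (ht : 2 ≤ t) : (1 / 4 : ℚ) ≤ p t := by
  have h := euler_lb (t - 1) (by omega)
  have h0 : (0 : ℚ) < (1 / 2) ^ (t - 1 + 1) := by positivity
  have h2 : ∏ i ∈ Finset.Icc 1 (t - 1), (1 - (1 / 2 : ℚ) ^ i) ≤ p t := by
    unfold p
    apply Finset.prod_le_prod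
    · intro i _
      have : (1 / 2 : ℚ) ^ i ≤ 1 := pow_le_one₀ (by norm_num) (by norm_num)
      linarith
    · intro i hi
      rw [Finset.mem_Icc] at hi
      have h1t : (1 : ℚ) < 2 ^ t := one_lt_pow₀ (by norm_num) (by omega)
      have hle : (1 / 2 : ℚ) ^ i ≤ 1 := pow_le_one₀ (by norm_num) (by norm_num)
      have e : (2 : ℚ) ^ (t - i) = 2 ^ t * (1 / 2) ^ i := by
        have : (2 : ℚ) ^ t = 2 ^ (t - i) * 2 ^ i := by rw [← pow_add]; congr 1; omega
        rw [this, mul_assoc, ← mul_pow]; norm_num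
      rw [e, le_div_iff₀ (by linarith)]
      nlinarith
  linarith

/-- For every `t ≥ 1`, `(p t)³ ≥ (24/49)^t`, i.e. `p t ≥ p 3 ^ (t/3)`. -/
theorem p_cubed_ge (t : ℕ) (ht : 1 ≤ t) : (p t) ^ 3 ≥ (24 / 49 : ℚ) ^ t := by
  by_cases h6 : 6 ≤ t
  · have h1 : (1 / 4 : ℚ) ^ 3 ≤ p t ^ 3 :=
      pow_le_pow_left₀ (by norm_num) (p_lb t (by omega)) 3
    have h2 : (24 / 49 : ℚ) ^ t ≤ (24 / 49) ^ 6 :=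
      pow_le_pow_of_le_one (by norm_num) (by norm_num) h6
    have h3 : (24 / 49 : ℚ) ^ 6 ≤ (1 / 4) ^ 3 := by norm_num
    linarith
  · have h5 : t ≤ 5 := by omega
    interval_cases t <;> norm_num [p, Finset.prod_Icc_succ_top]
end
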